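/- arXiv:2112.09025 — 3 statements merged into one kernel-verified Lean document; each statement's English description precedes it below -/
import Mathlib

section
/- Let E be a real inner product space, let s, wa, wb ∈ E with ‖wb‖ > 0, let α < 1 be a real constant and d > 0 a real constant, and assume ⟨wa, wb⟩ ≤ α·‖wb‖² and ⟨wa − wb, s⟩ < d. Then, setting ε = 2d/((1−α)·‖wb‖²), one has ⟨s + ε·wb, wa − wb⟩ < 0. -/
open RealInnerProductSpace

/-- Key inequality in the proof of Proposition 1: shifting the state `s` by
`ε • wb` with `ε = 2d/((1-α)‖wb‖²)` pushes the linear score of action `b`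
above that of action `a`. -/
theorem highSensitivity_key_inequality
    {E : Type*} [NormedAddCommGroup E] [InnerProductSpace ℝ E]
    (s wa wb : E) (α d : ℝ) (hα : α < 1) (hd : 0 < d) (hwb : 0 < ‖wb‖)
    (hcorr : ⟪wa, wb⟫ ≤ α * ‖wb‖ ^ 2)
    (hgap : ⟪wa - wb, s⟫ < d) :
    ⟪s + (2 * d / ((1 - α) * ‖wb‖ ^ 2)) • wb, wa - wb⟫ < 0 := by
  have hpos : 0 < (1 - α) * ‖wb‖ ^ 2 := mul_pos (sub_pos.mpr hα) (pow_pos hwb 2)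
  have hcancel : 2 * d / ((1 - α) * ‖wb‖ ^ 2) * ((1 - α) * ‖wb‖ ^ 2) = 2 * d :=
    div_mul_cancel₀ _ hpos.ne'
  have hinner : ⟪wb, wa - wb⟫ ≤ -((1 - α) * ‖wb‖ ^ 2) := by
    rw [inner_sub_right, real_inner_self_eq_norm_sq, real_inner_comm]
    linarith
  have hshift := mul_le_mul_of_nonneg_left hinner (div_pos (mul_pos two_pos hd) hpos).le
  rw [mul_neg, hcancel] at hshift
  rw [real_inner_comm] at hgap
  rw [inner_add_left, real_inner_smul_left]
  linarith
end

section
/- Let E be a real inner product space. Let s, r, w★, wa, wb ∈ E, and let α < 1, β ≥ 1, c > 0, d > 0 be real constants. Assume: (i) ‖wb‖ > 0; (ii) ‖w★‖ ≤ β·‖wb‖, ‖wa‖ ≤ β·‖wb‖, ‖wb‖ ≤ β·‖w★‖ and ‖wb‖ ≤ β·‖wa‖; (iii) |⟨r, w★⟩| ≤ c·(1−α)·‖w★‖·‖wb‖/(8·d·β³) and |⟨r, wa⟩| ≤ c·(1−α)·‖wa‖·‖wb‖/(8·d·β³); and (iv) c < ⟨w★ − wa, s⟩. Then, setting ε = 2d/((1−α)·‖wb‖²),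 one has ⟨s + ε·r, w★ − wa⟩ > c/2 > 0; in particular ⟨w★, s + ε·r⟩ > ⟨wa, s + ε·r⟩. -/
open RealInnerProductSpace

theorem scaled_abs_le_quarter {α β c d x m b : ℝ} (hα : α < 1) (hβ : 1 ≤ β) (hc : 0 < c)
    (hd : 0 < d) (hb : 0 < b) (hm : m ≤ β * b)
    (hx : |x| ≤ c * (1 - α) * m * b / (8 * d * β ^ 3)) :
    |2 * d / ((1 - α) * b ^ 2) * x| ≤ c / 4 := by
  have hα' : 0 < 1 - α := sub_pos.2 hα
  have hβ' : 0 < β := one_pos.trans_le hβ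
  rw [abs_mul, abs_of_pos (by positivity : 0 < 2 * d / ((1 - α) * b ^ 2))]
  calc 2 * d / ((1 - α) * b ^ 2) * |x|
      ≤ 2 * d / ((1 - α) * b ^ 2) * (c * (1 - α) * (β * b) * b / (8 * d * β ^ 3)) := by
        refine mul_le_mul_of_nonneg_left (hx.trans ?_) (by positivity)
        gcongr
    _ = c / 4 / β ^ 2 := by
        field_simp
        norm_num
    _ ≤ c / 4 := div_le_self (by positivity) (one_le_pow₀ hβ)

/-- Step in the proof of Proposition 1 with the concentration parameter set to
`t = c(1-α)√n/(8dβ³)`: the score gap between the optimal action and any other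
action remains at least `c/2` after an `ε`-perturbation along `r`, where
`ε = 2d/((1-α)‖wb‖²)`. -/
theorem random_direction_gap_half
    {E : Type*} [NormedAddCommGroup E] [InnerProductSpace ℝ E]
    (s r wstar wa wb : E)
    (α β c d : ℝ) (hα : α < 1) (hβ : 1 ≤ β) (hc : 0 < c) (hd : 0 < d)
    (hwb : 0 < ‖wb‖)
    (h1 : ‖wstar‖ ≤ β * ‖wb‖) (h2 : ‖wa‖ ≤ β * ‖wb‖)
    (h3 : ‖wb‖ ≤ β * ‖wstar‖) (h4 : ‖wb‖ ≤ β * ‖wa‖)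
    (h5 : |⟪r, wstar⟫| ≤ c * (1 - α) * ‖wstar‖ * ‖wb‖ / (8 * d * β ^ 3))
    (h6 : |⟪r, wa⟫| ≤ c * (1 - α) * ‖wa‖ * ‖wb‖ / (8 * d * β ^ 3))
    (h7 : c < ⟪wstar - wa, s⟫) :
    ⟪s + (2 * d / ((1 - α) * ‖wb‖ ^ 2)) • r, wstar - wa⟫ > c / 2 ∧
      (0 : ℝ) < c / 2 ∧
      ⟪wa, s + (2 * d / ((1 - α) * ‖wb‖ ^ 2)) • r⟫ <
        ⟪wstar, s + (2 * d / ((1 - α) * ‖wb‖ ^ 2)) • r⟫ := by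
  have hstar := abs_le.1 (scaled_abs_le_quarter hα hβ hc hd hwb h1 h5)
  have ha := abs_le.1 (scaled_abs_le_quarter hα hβ hc hd hwb h2 h6)
  generalize 2 * d / ((1 - α) * ‖wb‖ ^ 2) = ε at *
  have hgap : ⟪s + ε • r, wstar - wa⟫ > c / 2 := by
    rw [inner_add_left, real_inner_smul_left, inner_sub_right r, mul_sub,
      real_inner_comm (wstar - wa) s]
    linarith [hstar.1, ha.2]
  refine ⟨hgap, half_pos hc, ?_⟩
  rw [real_inner_comm, inner_sub_left] at hgap
  linarith
end

section
/- Let E be a real inner product space, let A be a finite nonempty set (the action set), let w : A → E, let s ∈ E, and fix b ∈ A with ‖w b‖ > 0 and a★ ∈ A. Let α < 1, β ≥ 1, c > 0, d > 0 be real constants. Assume: (i) for all a, a' ∈ A, ‖w a‖ ≤ β·‖w a'‖; (ii) for every a ∈ A with a ≠ a★, c < ⟨w a★, s⟩ − ⟨w a, s⟩; and (iii) the vector r ∈ E satisfies |⟨r, w a⟩| ≤ c·(1−α)·‖w a‖·‖w b‖/(8·d·β³) for every a ∈ A. Then, setting ε = 2d/((1−α)·‖w b‖²), for every a ∈ A with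 a ≠ a★ one has ⟨w a★, s + ε·r⟩ > ⟨w a, s + ε·r⟩; in particular a★ is the unique maximizer over A of the map a ↦ ⟨w a, s + ε·r⟩. -/
open RealInnerProductSpace

/-- If `x` is small relative to the lengths `u ≤ β v` and `v`, then scaling it by
`2d/((1-α)v²)` leaves at most a quarter of the gap `c`. -/
theorem abs_scaled_le_quarter {α β c d u v x : ℝ} (hα : α < 1) (hβ : 1 ≤ β) (hc : 0 < c)
    (hd : 0 < d) (hv : 0 < v) (huv : u ≤ β * v)
    (hx : |x| ≤ c * (1 - α) * u * v / (8 * d * β ^ 3)) :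
    |2 * d / ((1 - α) * v ^ 2) * x| ≤ c / 4 := by
  have hα' : 0 < 1 - α := sub_pos.mpr hα
  have hβ' : 0 < β := one_pos.trans_le hβ
  rw [abs_mul, abs_of_pos (by positivity)]
  calc 2 * d / ((1 - α) * v ^ 2) * |x|
      ≤ 2 * d / ((1 - α) * v ^ 2) * (c * (1 - α) * (β * v) * v / (8 * d * β ^ 3)) := by
        refine mul_le_mul_of_nonneg_left (hx.trans ?_) (by positivity)
        gcongr
    _ = c / 4 / β ^ 2 := by
        field_simp
        norm_num
    _ ≤ c / 4 := div_le_self (by positivity) (one_le_pow₀ hβ)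

/-- Random-direction half of Proposition 1 (after the union bound): on the
event that the random direction `r` is nearly orthogonal to all weight
vectors, an `ε`-perturbation along `r` with `ε = 2d/((1-α)‖w b‖²)` does not
change the action taken by the linear policy. -/
theorem random_perturbation_preserves_action
    {E : Type*} [NormedAddCommGroup E] [InnerProductSpace ℝ E]
    {A : Type*} [Fintype A] [Nonempty A]
    (w : A → E) (s : E) (b astar : A)
    (α β c d : ℝ) (hα : α < 1) (hβ : 1 ≤ β) (hc : 0 < c) (hd : 0 < d)
    (hwb : 0 < ‖w b‖)
    (hlen : ∀ a a' : A, ‖w a‖ ≤ β * ‖w a'‖)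
    (hgap : ∀ a, a ≠ astar → c < ⟪w astar, s⟫ - ⟪w a, s⟫)
    (r : E)
    (hr : ∀ a : A, |⟪r, w a⟫| ≤ c * (1 - α) * ‖w a‖ * ‖w b‖ / (8 * d * β ^ 3)) :
    (∀ a, a ≠ astar →
        ⟪w a, s + (2 * d / ((1 - α) * ‖w b‖ ^ 2)) • r⟫ <
          ⟪w astar, s + (2 * d / ((1 - α) * ‖w b‖ ^ 2)) • r⟫) ∧
    (∀ a : A,
        (∀ a' : A,
            ⟪w a', s + (2 * d / ((1 - α) * ‖w b‖ ^ 2)) • r⟫ ≤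
              ⟪w a, s + (2 * d / ((1 - α) * ‖w b‖ ^ 2)) • r⟫) →
        a = astar) := by
  have key : ∀ a, a ≠ astar →
      ⟪w a, s + (2 * d / ((1 - α) * ‖w b‖ ^ 2)) • r⟫ <
        ⟪w astar, s + (2 * d / ((1 - α) * ‖w b‖ ^ 2)) • r⟫ := by
    intro a ha
    have hsmall (a' : A) := abs_le.mp (abs_scaled_le_quarter hα hβ hc hd hwb (hlen a' b) (hr a'))
    simp only [inner_add_right, real_inner_smul_right, real_inner_comm r]
    linarith [hgap a ha, (hsmall a).2, (hsmall astar).1]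
  refine ⟨key, fun a hmax => ?_⟩
  by_contra ha
  exact (key a ha).not_ge (hmax astar)
end
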